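/- arXiv:1612.07918 — 3 statements merged into one kernel-verified Lean document; each statement's English description precedes it below -/
import Mathlib

section
/- Let U ⊆ ℝ² be open and ψ : U → ℝ be smooth and harmonic (ψ_xx + ψ_yy = 0) with ∇ψ(x,y) ≠ 0 for all (x,y) ∈ U, let C ∈ ℝ, and set p = C - ½|∇ψ|². Then p_xx + p_yy = -2(p_x² + p_y²)/(ψ_x² + ψ_y²) on U. In particular p_xx + p_yy ≤ 0, i.e. p is superharmonic on U, and p satisfies the quasilinear elliptic equation p_xx + p_yy + a·p_x + b·p_y = 0 with coefficients a = 2p_x/(ψ_x² + ψ_y²) and b = 2p_y/(ψ_x² + ψ_y²). -/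
open Real Filter Set

/-- Partial derivative in the first (horizontal) variable. -/
noncomputable def pdx (f : ℝ → ℝ → ℝ) (x y : ℝ) : ℝ := deriv (fun t => f t y) x

/-- Partial derivative in the second (vertical) variable. -/
noncomputable def pdy (f : ℝ → ℝ → ℝ) (x y : ℝ) : ℝ := deriv (fun t => f x t) y

section PartialDerivatives

variable {U : Set (ℝ × ℝ)} {f g : ℝ → ℝ → ℝ} {x y : ℝ}

theorem hasDerivAt_fderiv_fst (hU : IsOpen U)
    (hf : ContDiffOn ℝ (⊤ : ℕ∞) (fun q : ℝ × ℝ => f q.1 q.2) U) (h : (x, y) ∈ U) :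
    HasDerivAt (fun t => f t y) (fderiv ℝ (fun q : ℝ × ℝ => f q.1 q.2) (x, y) (1, 0)) x := by
  have hd := ((hf.contDiffAt (hU.mem_nhds h)).differentiableAt (by simp)).hasFDerivAt
  exact hd.comp_hasDerivAt x ((hasDerivAt_id x).prodMk (hasDerivAt_const x y))

theorem hasDerivAt_fderiv_snd (hU : IsOpen U)
    (hf : ContDiffOn ℝ (⊤ : ℕ∞) (fun q : ℝ × ℝ => f q.1 q.2) U) (h : (x, y) ∈ U) :
    HasDerivAt (fun t => f x t) (fderiv ℝ (fun q : ℝ × ℝ => f q.1 q.2) (x, y) (0, 1)) y := by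
  have hd := ((hf.contDiffAt (hU.mem_nhds h)).differentiableAt (by simp)).hasFDerivAt
  exact hd.comp_hasDerivAt y ((hasDerivAt_const y x).prodMk (hasDerivAt_id y))

theorem pdx_eq_fderiv (hU : IsOpen U)
    (hf : ContDiffOn ℝ (⊤ : ℕ∞) (fun q : ℝ × ℝ => f q.1 q.2) U) (h : (x, y) ∈ U) :
    pdx f x y = fderiv ℝ (fun q : ℝ × ℝ => f q.1 q.2) (x, y) (1, 0) :=
  (hasDerivAt_fderiv_fst hU hf h).deriv

theorem pdy_eq_fderiv (hU : IsOpen U)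
    (hf : ContDiffOn ℝ (⊤ : ℕ∞) (fun q : ℝ × ℝ => f q.1 q.2) U) (h : (x, y) ∈ U) :
    pdy f x y = fderiv ℝ (fun q : ℝ × ℝ => f q.1 q.2) (x, y) (0, 1) :=
  (hasDerivAt_fderiv_snd hU hf h).deriv

theorem hasDerivAt_pdx (hU : IsOpen U)
    (hf : ContDiffOn ℝ (⊤ : ℕ∞) (fun q : ℝ × ℝ => f q.1 q.2) U) (h : (x, y) ∈ U) :
    HasDerivAt (fun t => f t y) (pdx f x y) x :=
  (hasDerivAt_fderiv_fst hU hf h).differentiableAt.hasDerivAt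

theorem hasDerivAt_pdy (hU : IsOpen U)
    (hf : ContDiffOn ℝ (⊤ : ℕ∞) (fun q : ℝ × ℝ => f q.1 q.2) U) (h : (x, y) ∈ U) :
    HasDerivAt (fun t => f x t) (pdy f x y) y :=
  (hasDerivAt_fderiv_snd hU hf h).differentiableAt.hasDerivAt

theorem ContDiffOn.pdx (hf : ContDiffOn ℝ (⊤ : ℕ∞) (fun q : ℝ × ℝ => f q.1 q.2) U)
    (hU : IsOpen U) : ContDiffOn ℝ (⊤ : ℕ∞) (fun q : ℝ × ℝ => pdx f q.1 q.2) U :=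
  ((hf.fderiv_of_isOpen hU (by simp)).clm_apply contDiffOn_const).congr
    fun _ h => pdx_eq_fderiv hU hf h

theorem ContDiffOn.pdy (hf : ContDiffOn ℝ (⊤ : ℕ∞) (fun q : ℝ × ℝ => f q.1 q.2) U)
    (hU : IsOpen U) : ContDiffOn ℝ (⊤ : ℕ∞) (fun q : ℝ × ℝ => pdy f q.1 q.2) U :=
  ((hf.fderiv_of_isOpen hU (by simp)).clm_apply contDiffOn_const).congr
    fun _ h => pdy_eq_fderiv hU hf h

theorem pdx_congr (hU : IsOpen U) (hfg : ∀ x y, (x, y) ∈ U → f x y = g x y)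
    (h : (x, y) ∈ U) : pdx f x y = pdx g x y := by
  have hc : ContinuousAt (fun t : ℝ => (t, y)) x := by fun_prop
  refine Filter.EventuallyEq.deriv_eq ?_
  filter_upwards [hc.preimage_mem_nhds (hU.mem_nhds h)] with t ht using hfg t y ht

theorem pdy_congr (hU : IsOpen U) (hfg : ∀ x y, (x, y) ∈ U → f x y = g x y)
    (h : (x, y) ∈ U) : pdy f x y = pdy g x y := by
  have hc : ContinuousAt (fun t : ℝ => (x, t)) y := by fun_prop
  refine Filter.EventuallyEq.deriv_eq ?_
  filter_upwards [hc.preimage_mem_nhds (hU.mem_nhds h)] with t ht using hfg x t ht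

/-- Mixed partial derivatives of a smooth function on an open set commute. -/
theorem pdx_pdy_comm (hU : IsOpen U)
    (hf : ContDiffOn ℝ (⊤ : ℕ∞) (fun q : ℝ × ℝ => f q.1 q.2) U) (h : (x, y) ∈ U) :
    pdx (pdy f) x y = pdy (pdx f) x y := by
  have hd : HasFDerivAt (fderiv ℝ fun q : ℝ × ℝ => f q.1 q.2)
      (fderiv ℝ (fderiv ℝ fun q : ℝ × ℝ => f q.1 q.2) (x, y)) (x, y) :=
    (((hf.fderiv_of_isOpen hU (m := (⊤ : ℕ∞)) (by simp)).contDiffAt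
      (hU.mem_nhds h)).differentiableAt (by simp)).hasFDerivAt
  have hsymm : IsSymmSndFDerivAt ℝ (fun q : ℝ × ℝ => f q.1 q.2) (x, y) :=
    (hf.contDiffAt (hU.mem_nhds h)).isSymmSndFDerivAt
      (by simpa using WithTop.coe_le_coe.2 (le_top : (2 : ℕ∞) ≤ ⊤))
  have hx : (fun q : ℝ × ℝ => pdx f q.1 q.2) =ᶠ[nhds (x, y)]
      fun q => fderiv ℝ (fun q : ℝ × ℝ => f q.1 q.2) q (1, 0) := by
    filter_upwards [hU.mem_nhds h] with q hq using pdx_eq_fderiv hU hf hq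
  have hy : (fun q : ℝ × ℝ => pdy f q.1 q.2) =ᶠ[nhds (x, y)]
      fun q => fderiv ℝ (fun q : ℝ × ℝ => f q.1 q.2) q (0, 1) := by
    filter_upwards [hU.mem_nhds h] with q hq using pdy_eq_fderiv hU hf hq
  rw [pdx_eq_fderiv hU (hf.pdy hU) h, pdy_eq_fderiv hU (hf.pdx hU) h, hx.fderiv_eq, hy.fderiv_eq,
    (hd.clm_apply (hasFDerivAt_const _ _)).fderiv, (hd.clm_apply (hasFDerivAt_const _ _)).fderiv]
  simpa using hsymm.eq (1, 0) (0, 1)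

end PartialDerivatives

/-- If `ψ` is smooth and harmonic with nonvanishing gradient on an open set `U`, then
`p = C - ½|∇ψ|²` satisfies `Δp = -2|∇p|²/|∇ψ|² ≤ 0` (so `p` is superharmonic on `U`)
and the quasilinear elliptic equation `Δp + a·p_x + b·p_y = 0` with
`a = 2p_x/|∇ψ|²`, `b = 2p_y/|∇ψ|²`. -/
theorem superharmonic_dynamic_pressure
    (U : Set (ℝ × ℝ)) (hU : IsOpen U)
    (ψ : ℝ → ℝ → ℝ) (hψ : ContDiffOn ℝ (⊤ : ℕ∞) (fun q : ℝ × ℝ => ψ q.1 q.2) U)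
    (hharm : ∀ x y, (x, y) ∈ U → pdx (pdx ψ) x y + pdy (pdy ψ) x y = 0)
    (hgrad : ∀ x y, (x, y) ∈ U → (pdx ψ x y, pdy ψ x y) ≠ (0, 0))
    (C : ℝ) (p : ℝ → ℝ → ℝ)
    (hp : ∀ x y, p x y = C - (1 / 2) * ((pdx ψ x y) ^ 2 + (pdy ψ x y) ^ 2)) :
    ∀ x y, (x, y) ∈ U →
      (pdx (pdx p) x y + pdy (pdy p) x y =
        -(2 * ((pdx p x y) ^ 2 + (pdy p x y) ^ 2)) /
          ((pdx ψ x y) ^ 2 + (pdy ψ x y) ^ 2)) ∧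
      pdx (pdx p) x y + pdy (pdy p) x y ≤ 0 ∧
      pdx (pdx p) x y + pdy (pdy p) x y
        + (2 * pdx p x y / ((pdx ψ x y) ^ 2 + (pdy ψ x y) ^ 2)) * pdx p x y
        + (2 * pdy p x y / ((pdx ψ x y) ^ 2 + (pdy ψ x y) ^ 2)) * pdy p x y = 0 := by
  have hx : ContDiffOn ℝ (⊤ : ℕ∞) (fun q : ℝ × ℝ => pdx ψ q.1 q.2) U := hψ.pdx hU
  have hy : ContDiffOn ℝ (⊤ : ℕ∞) (fun q : ℝ × ℝ => pdy ψ q.1 q.2) U := hψ.pdy hU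
  have hyx : ∀ x y, (x, y) ∈ U → pdx (pdy ψ) x y = pdy (pdx ψ) x y :=
    fun x y h => pdx_pdy_comm hU hψ h
  have hyy : ∀ x y, (x, y) ∈ U → pdy (pdy ψ) x y = -pdx (pdx ψ) x y :=
    fun x y h => by linarith [hharm x y h]
  have hpx : ∀ x y, (x, y) ∈ U → pdx p x y =
      -(pdx ψ x y * pdx (pdx ψ) x y + pdy ψ x y * pdx (pdy ψ) x y) := by
    intro x y h
    have h1 := hasDerivAt_pdx hU hx h
    have h2 := hasDerivAt_pdx hU hy h
    have h3 := (((h1.pow 2).add (h2.pow 2)).const_mul (1 / 2)).const_sub C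
    refine Eq.trans ?_ (h3.deriv.trans ?_)
    · exact congrArg (fun g => deriv g x) (funext fun t => hp t y)
    · push_cast; ring
  have hpy : ∀ x y, (x, y) ∈ U → pdy p x y =
      -(pdx ψ x y * pdy (pdx ψ) x y + pdy ψ x y * pdy (pdy ψ) x y) := by
    intro x y h
    have h1 := hasDerivAt_pdy hU hx h
    have h2 := hasDerivAt_pdy hU hy h
    have h3 := (((h1.pow 2).add (h2.pow 2)).const_mul (1 / 2)).const_sub C
    refine Eq.trans ?_ (h3.deriv.trans ?_)
    · exact congrArg (fun g => deriv g y) (funext fun t => hp x t)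
    · push_cast; ring
  intro x y h
  have hpxx : pdx (pdx p) x y =
      -(pdx (pdx ψ) x y ^ 2 + pdx ψ x y * pdx (pdx (pdx ψ)) x y
        + (pdx (pdy ψ) x y ^ 2 + pdy ψ x y * pdx (pdx (pdy ψ)) x y)) := by
    rw [pdx_congr hU hpx h]
    refine (((hasDerivAt_pdx hU hx h).mul (hasDerivAt_pdx hU (hx.pdx hU) h)).add
      ((hasDerivAt_pdx hU hy h).mul (hasDerivAt_pdx hU (hy.pdx hU) h))).neg.deriv.trans ?_
    ring
  have hpyy : pdy (pdy p) x y =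
      -(pdy (pdx ψ) x y ^ 2 + pdx ψ x y * pdy (pdy (pdx ψ)) x y
        + (pdy (pdy ψ) x y ^ 2 + pdy ψ x y * pdy (pdy (pdy ψ)) x y)) := by
    rw [pdy_congr hU hpy h]
    refine (((hasDerivAt_pdy hU hx h).mul (hasDerivAt_pdy hU (hx.pdy hU) h)).add
      ((hasDerivAt_pdy hU hy h).mul (hasDerivAt_pdy hU (hy.pdy hU) h))).neg.deriv.trans ?_
    ring
  have hxyy : pdy (pdy (pdx ψ)) x y = -pdx (pdx (pdx ψ)) x y := by
    rw [← pdy_congr hU hyx h, ← pdx_pdy_comm hU hy h, pdx_congr hU hyy h]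
    exact deriv.fun_neg
  have hyyy : pdy (pdy (pdy ψ)) x y = -pdx (pdx (pdy ψ)) x y := by
    rw [pdx_congr hU hyx h, pdx_pdy_comm hU hx h, pdy_congr hU hyy h]
    exact deriv.fun_neg
  have hpos : 0 < pdx ψ x y ^ 2 + pdy ψ x y ^ 2 := by
    by_contra! hle
    refine hgrad x y h (Prod.ext ?_ ?_) <;>
      exact pow_eq_zero_iff two_ne_zero |>.1
        (by nlinarith [sq_nonneg (pdx ψ x y), sq_nonneg (pdy ψ x y)])
  have hlap : pdx (pdx p) x y + pdy (pdy p) x y =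
      -(2 * ((pdx p x y) ^ 2 + (pdy p x y) ^ 2)) /
        ((pdx ψ x y) ^ 2 + (pdy ψ x y) ^ 2) := by
    rw [eq_div_iff hpos.ne', hpxx, hpyy, hpx x y h, hpy x y h, hxyy, hyyy, hyy x y h, hyx x y h]
    ring
  refine ⟨hlap, ?_, ?_⟩
  · rw [hlap]
    refine div_nonpos_of_nonpos_of_nonneg (neg_nonpos.2 ?_) hpos.le
    positivity
  · rw [hlap]
    ring
end

section
/- The dynamic pressure is strictly decreasing along the bed away from the crest: p_x(x,-d) < 0 for every x > 0, and consequently the map x ↦ p(x,-d) is strictly decreasing on [0,∞). -/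
open Real Filter Set

theorem im_le_of_forall_mem_frontier_im_le {U : Set ℂ} (hU : Bornology.IsBounded U) {f : ℂ → ℂ}
    (hf : DiffContOnCl ℂ f U) {C : ℝ} (hC : ∀ z ∈ frontier U, (f z).im ≤ C) {z : ℂ}
    (hz : z ∈ closure U) : (f z).im ≤ C := by
  have hexp : ∀ w, ‖Complex.exp (-Complex.I * f w)‖ = Real.exp (f w).im := fun w => by
    simp [Complex.norm_exp]
  have key := Complex.norm_le_of_forall_mem_frontier_norm_le hU
    (f := fun w => Complex.exp (-Complex.I * f w)) (C := Real.exp C)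
    ((by fun_prop : Differentiable ℂ fun w : ℂ => Complex.exp (-Complex.I * w)).comp_diffContOnCl hf)
    (fun w hw => by rw [hexp]; exact Real.exp_le_exp.2 (hC w hw)) hz
  rw [hexp] at key
  exact Real.exp_le_exp.1 key

theorem im_eq_of_isPreconnected_of_isMaxOn_im {U : Set ℂ} (hc : IsPreconnected U) (ho : IsOpen U)
    {f : ℂ → ℂ} (hf : DifferentiableOn ℂ f U) {a z : ℂ} (ha : a ∈ U)
    (hm : ∀ w ∈ U, (f w).im ≤ (f a).im) (hz : z ∈ U) : (f z).im = (f a).im := by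
  have hexp : ∀ w, ‖Complex.exp (-Complex.I * f w)‖ = Real.exp (f w).im := fun w => by
    simp [Complex.norm_exp]
  have key := Complex.norm_eqOn_of_isPreconnected_of_isMaxOn hc ho
    (f := fun w => Complex.exp (-Complex.I * f w))
    ((hf.const_mul (-Complex.I)).cexp) ha
    (fun w hw => by
      simp only [Set.mem_ofPred_eq, Function.comp_apply, hexp]
      exact Real.exp_le_exp.2 (hm w hw)) hz
  simp only [Function.comp_apply, Function.const_apply, hexp] at key
  exact Real.exp_injective key

theorem hasDerivAt_fst_slice {w : ℝ → ℝ → ℝ} (hw : ContDiff ℝ (⊤ : ℕ∞) (fun q : ℝ × ℝ => w q.1 q.2))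
    (x y : ℝ) : HasDerivAt (fun t => w t y) (fderiv ℝ (fun q : ℝ × ℝ => w q.1 q.2) (x, y) (1, 0)) x :=
  (hw.differentiable (by simp) (x, y)).hasFDerivAt.comp_hasDerivAt (f := fun t => (t, y)) x
    ((hasDerivAt_id x).prodMk (hasDerivAt_const x y))

theorem hasDerivAt_snd_slice {w : ℝ → ℝ → ℝ} (hw : ContDiff ℝ (⊤ : ℕ∞) (fun q : ℝ × ℝ => w q.1 q.2))
    (x y : ℝ) : HasDerivAt (fun t => w x t) (fderiv ℝ (fun q : ℝ × ℝ => w q.1 q.2) (x, y) (0, 1)) y :=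
  (hw.differentiable (by simp) (x, y)).hasFDerivAt.comp_hasDerivAt (f := fun t => (x, t)) y
    ((hasDerivAt_const y x).prodMk (hasDerivAt_id y))

/-- The complex velocity `u - i v`. -/
noncomputable def complexVelocity (u v : ℝ → ℝ → ℝ) (z : ℂ) : ℂ :=
  (u z.re z.im : ℂ) - (v z.re z.im : ℂ) * Complex.I

theorem complexVelocity_im (u v : ℝ → ℝ → ℝ) (z : ℂ) :
    (complexVelocity u v z).im = -v z.re z.im := by
  simp [complexVelocity]

theorem differentiableAt_complexVelocity {u v : ℝ → ℝ → ℝ}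
    (hu : ContDiff ℝ (⊤ : ℕ∞) (fun q : ℝ × ℝ => u q.1 q.2))
    (hv : ContDiff ℝ (⊤ : ℕ∞) (fun q : ℝ × ℝ => v q.1 q.2)) {z : ℂ}
    (hinc : pdx u z.re z.im + pdy v z.re z.im = 0)
    (hirr : pdy u z.re z.im - pdx v z.re z.im = 0) :
    DifferentiableAt ℂ (complexVelocity u v) z := by
  simp only [pdx, pdy, (hasDerivAt_fst_slice hu _ _).deriv, (hasDerivAt_snd_slice hu _ _).deriv,
    (hasDerivAt_fst_slice hv _ _).deriv, (hasDerivAt_snd_slice hv _ _).deriv] at hinc hirr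
  have hU := ((hu.differentiable (by simp) (z.re, z.im)).hasFDerivAt.comp z
    (Complex.equivRealProdCLM.toContinuousLinearMap.hasFDerivAt (x := z)))
  have hV := ((hv.differentiable (by simp) (z.re, z.im)).hasFDerivAt.comp z
    (Complex.equivRealProdCLM.toContinuousLinearMap.hasFDerivAt (x := z)))
  have hF := (Complex.ofRealCLM.hasFDerivAt.comp z hU).sub
    ((Complex.ofRealCLM.hasFDerivAt.comp z hV).mul_const Complex.I)
  have hF' : HasFDerivAt (complexVelocity u v) _ z := hF
  rw [differentiableAt_complex_iff_differentiableAt_real]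
  refine ⟨hF'.differentiableAt, ?_⟩
  rw [hF'.fderiv]
  simp [Complex.ext_iff]
  constructor <;> linarith

theorem isBounded_of_re_im_bounds {U : Set ℂ} {a b c d : ℝ}
    (h : ∀ z ∈ U, z.re ∈ Set.Icc a b ∧ z.im ∈ Set.Icc c d) : Bornology.IsBounded U :=
  ((Metric.isBounded_Icc a b).reProdIm (Metric.isBounded_Icc c d)).subset h

/-- The part of the fluid domain `-d < y < η x` lying to the right of the crest line. -/
def rightHalf (d : ℝ) (η : ℝ → ℝ) : Set ℂ := {z | 0 < z.re ∧ -d < z.im ∧ z.im < η z.re}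

theorem isOpen_rightHalf (d : ℝ) {η : ℝ → ℝ} (hη : Continuous η) : IsOpen (rightHalf d η) :=
  (isOpen_lt continuous_const Complex.continuous_re).inter
    ((isOpen_lt continuous_const Complex.continuous_im).inter
      (isOpen_lt Complex.continuous_im (hη.comp Complex.continuous_re)))

theorem isPreconnected_rightHalf {d : ℝ} {η : ℝ → ℝ} (hη : Continuous η) (hηd : ∀ x, -d < η x) :
    IsPreconnected (rightHalf d η) := by
  have himg : rightHalf d η = (fun q : ℝ × ℝ => ((q.1 : ℂ) +
      ((-d + q.2 * (η q.1 + d) : ℝ) : ℂ) * Complex.I)) '' (Set.Ioi 0 ×ˢ Set.Ioo 0 1) := by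
    ext z
    constructor
    · rintro ⟨h0, h1, h2⟩
      have hpos : 0 < η z.re + d := by linarith [hηd z.re]
      refine ⟨(z.re, (z.im + d) / (η z.re + d)), ⟨h0, div_pos (by linarith) hpos,
        (div_lt_one hpos).2 (by linarith)⟩, ?_⟩
      apply Complex.ext
      · simp only [Complex.add_re, Complex.ofReal_re, Complex.re_ofReal_mul, Complex.I_re, mul_zero,
          add_zero]
      · simp only [Complex.add_im, Complex.ofReal_im, Complex.im_ofReal_mul, Complex.I_im,
          div_mul_cancel₀ _ hpos.ne']
        ring
    · rintro ⟨⟨x, t⟩, ⟨hx, ht0, ht1⟩, rfl⟩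
      have hpos : 0 < η x + d := by linarith [hηd x]
      simp only [Set.mem_Ioi] at hx ht0 ht1
      simp only [rightHalf, Set.mem_ofPred_eq]
      simp
      refine ⟨hx, by positivity, by nlinarith⟩
  rw [himg]
  refine IsPreconnected.image ?_ _ (by fun_prop)
  exact isPreconnected_Ioi.prod isPreconnected_Ioo

theorem mem_closure_fluid {d : ℝ} {η : ℝ → ℝ} (hηd : ∀ x, -d < η x) {x y : ℝ}
    (h1 : -d ≤ y) (h2 : y ≤ η x) :
    (x, y) ∈ closure {q : ℝ × ℝ | -d < q.2 ∧ q.2 < η q.1} := by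
  have hy : y ∈ closure (Set.Ioo (-d) (η x)) := by
    rw [closure_Ioo (hηd x).ne]; exact ⟨h1, h2⟩
  exact map_mem_closure (f := fun t => (x, t)) (by fun_prop) hy (fun t ht => ht)

/-- Weak maximum principle on the unbounded right half of the fluid domain. -/
theorem nonneg_on_rightHalf {d : ℝ} {η : ℝ → ℝ} (hη : Continuous η)
    {u v : ℝ → ℝ → ℝ} (hv : Continuous (fun q : ℝ × ℝ => v q.1 q.2))
    (hu : Continuous (fun q : ℝ × ℝ => u q.1 q.2))
    (hf : DifferentiableOn ℂ (complexVelocity u v) (rightHalf d η))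
    (hsurf : ∀ x, 0 < x → 0 ≤ v x (η x)) (hbed : ∀ x, v x (-d) = 0) (hcrest : ∀ y, v 0 y = 0)
    (hlim : ∀ ε > 0, ∃ R > 0, ∀ x y, -d ≤ y → y ≤ η x → R < |x| → |v x y| < ε) :
    ∀ z ∈ rightHalf d η, 0 ≤ v z.re z.im := by
  intro z hz
  by_contra! hneg
  obtain ⟨R, hR, hRv⟩ := hlim (-v z.re z.im / 2) (by linarith)
  set S := R + z.re + 1 with hS
  have hRS : R < S := by linarith [hz.1]
  set U : Set ℂ := rightHalf d η ∩ {w | w.re < S} with hUdef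
  have hUo : IsOpen U :=
    (isOpen_rightHalf d hη).inter (isOpen_lt Complex.continuous_re continuous_const)
  have hcl : closure U ⊆ {w | (0 ≤ w.re ∧ -d ≤ w.im ∧ w.im ≤ η w.re) ∧ w.re ≤ S} := by
    refine closure_minimal (fun w hw => ⟨⟨hw.1.1.le, hw.1.2.1.le, hw.1.2.2.le⟩, le_of_lt hw.2⟩) ?_
    exact ((isClosed_le continuous_const Complex.continuous_re).inter
      ((isClosed_le continuous_const Complex.continuous_im).inter
        (isClosed_le Complex.continuous_im (hη.comp Complex.continuous_re)))).inter
      (isClosed_le Complex.continuous_re continuous_const)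
  have hbdd : Bornology.IsBounded U := by
    obtain ⟨M, hM⟩ := (isCompact_Icc (a := (0 : ℝ)) (b := S)).bddAbove_image hη.continuousOn
    refine isBounded_of_re_im_bounds (a := 0) (b := S) (c := -d) (d := M) fun w hw => ?_
    have hwS : w.re ∈ Set.Icc 0 S := ⟨hw.1.1.le, le_of_lt hw.2⟩
    exact ⟨hwS, hw.1.2.1.le, hw.1.2.2.le.trans (hM ⟨_, hwS, rfl⟩)⟩
  have hcont : Continuous (complexVelocity u v) := by
    have h1 : Continuous fun w : ℂ => u w.re w.im :=
      hu.comp (Complex.continuous_re.prodMk Complex.continuous_im)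
    have h2 : Continuous fun w : ℂ => v w.re w.im :=
      hv.comp (Complex.continuous_re.prodMk Complex.continuous_im)
    unfold complexVelocity
    fun_prop
  have key := im_le_of_forall_mem_frontier_im_le hbdd
    (⟨hf.mono Set.inter_subset_left, hcont.continuousOn⟩ : DiffContOnCl ℂ _ U)
    (C := -v z.re z.im / 2) ?_ (subset_closure (⟨hz, by simp only [Set.mem_ofPred_eq]; linarith⟩ : z ∈ U))
  · rw [complexVelocity_im] at key
    linarith
  · intro w hw
    rw [hUo.frontier_eq] at hw
    obtain ⟨⟨⟨h0, h1, h2⟩, h3⟩, hnot⟩ := And.intro (hcl hw.1) hw.2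
    rw [complexVelocity_im]
    rcases h0.eq_or_lt with h0 | h0
    · rw [← h0, hcrest]; linarith
    rcases h1.eq_or_lt with h1 | h1
    · rw [← h1, hbed]; linarith
    rcases h2.eq_or_lt with h2 | h2
    · rw [h2]; linarith [hsurf _ h0]
    rcases h3.eq_or_lt with h3 | h3
    · have := hRv w.re w.im h1.le h2.le (by rw [h3, abs_of_pos (by linarith)]; exact hRS)
      linarith [neg_abs_le (v w.re w.im)]
    · exact absurd ⟨⟨h0, h1, h2⟩, h3⟩ hnot

/-- Strong maximum principle on the right half of the fluid domain. -/
theorem pos_on_rightHalf {d : ℝ} {η : ℝ → ℝ} (hη : Continuous η) (hηd : ∀ x, -d < η x)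
    {u v : ℝ → ℝ → ℝ} (hv : Continuous (fun q : ℝ × ℝ => v q.1 q.2))
    (hf : DifferentiableOn ℂ (complexVelocity u v) (rightHalf d η))
    (hnonneg : ∀ z ∈ rightHalf d η, 0 ≤ v z.re z.im)
    {x₁ : ℝ} (hx₁ : 0 < x₁) (hpos : 0 < v x₁ (η x₁)) :
    ∀ z ∈ rightHalf d η, 0 < v z.re z.im := by
  intro z hz
  refine (hnonneg z hz).lt_of_ne' fun hzero => ?_
  have hall : ∀ w ∈ rightHalf d η, v w.re w.im = 0 := fun w hw => by
    have := im_eq_of_isPreconnected_of_isMaxOn_im (isPreconnected_rightHalf hη hηd)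
      (isOpen_rightHalf d hη) hf hz
      (fun w hw => by simp only [complexVelocity_im, hzero]; linarith [hnonneg w hw]) hw
    simp only [complexVelocity_im, hzero] at this
    linarith
  have hclosed : IsClosed {y | v x₁ y = 0} :=
    isClosed_eq (hv.comp (Continuous.prodMk_right x₁)) continuous_const
  have hsub : Set.Ioo (-d) (η x₁) ⊆ {y | v x₁ y = 0} := fun y hy =>
    hall ⟨x₁, y⟩ ⟨hx₁, hy.1, hy.2⟩
  have := closure_minimal hsub hclosed
  rw [closure_Ioo (hηd x₁).ne] at this
  exact hpos.ne' (this (Set.right_mem_Icc.2 (hηd x₁).le))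

/-- Hopf's boundary-point lemma at a flat piece of boundary. -/
theorem hopf_flat {u v : ℝ → ℝ → ℝ} (hv : Continuous (fun q : ℝ × ℝ => v q.1 q.2))
    (hu : Continuous (fun q : ℝ × ℝ => u q.1 q.2)) {x₀ y₀ a b : ℝ} (ha : 0 < a) (hb : 0 < b)
    (hf : ∀ z : ℂ, |z.re - x₀| < a → y₀ < z.im → z.im < y₀ + b →
      DifferentiableAt ℂ (complexVelocity u v) z)
    (hbed : ∀ x, v x y₀ = 0)
    (hpos : ∀ x y, |x - x₀| ≤ a → y₀ < y → y ≤ y₀ + b → 0 < v x y)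
    {v' : ℝ} (hd : HasDerivAt (fun t => v x₀ t) v' y₀) : 0 < v' := by
  have htop : ContinuousOn (fun x => v x (y₀ + b)) (Set.Icc (x₀ - a) (x₀ + a)) :=
    (hv.comp (Continuous.prodMk_left (y₀ + b))).continuousOn
  obtain ⟨xm, hxm, hmin⟩ := isCompact_Icc.exists_isMinOn
    (Set.nonempty_Icc.2 (by linarith)) htop
  set m := v xm (y₀ + b) with hm
  have hmpos : 0 < m := hpos _ _ (abs_le.2 ⟨by linarith [hxm.1], by linarith [hxm.2]⟩)
    (by linarith) le_rfl
  set k := π / (2 * a) with hk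
  have hkpos : 0 < k := by positivity
  have hka : k * a = π / 2 := by rw [hk]; field_simp
  set δ := m / Real.sinh (k * b) with hδ
  have hsh : 0 < Real.sinh (k * b) := Real.sinh_pos_iff.2 (by positivity)
  have hδpos : 0 < δ := div_pos hmpos hsh
  set F : ℂ → ℂ := fun z => complexVelocity u v z +
    (δ : ℂ) * Complex.sin ((k : ℂ) * (z - ⟨x₀, y₀⟩)) with hF
  have hFim : ∀ z, (F z).im = -v z.re z.im +
      δ * (Real.cos (k * (z.re - x₀)) * Real.sinh (k * (z.im - y₀))) := fun z => by
    have harg : (k : ℂ) * (z - ⟨x₀, y₀⟩) =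
        ((k * (z.re - x₀) : ℝ) : ℂ) + ((k * (z.im - y₀) : ℝ) : ℂ) * Complex.I := by
      apply Complex.ext <;> simp
    have hs : (Complex.sin ((k : ℂ) * (z - ⟨x₀, y₀⟩))).im =
        Real.cos (k * (z.re - x₀)) * Real.sinh (k * (z.im - y₀)) := by
      rw [harg, Complex.sin_add_mul_I, ← Complex.ofReal_sin, ← Complex.ofReal_cos,
        ← Complex.ofReal_sinh, ← Complex.ofReal_cosh, ← Complex.ofReal_mul, ← Complex.ofReal_mul]
      simp only [Complex.add_im, Complex.ofReal_im, Complex.mul_im, Complex.I_re, Complex.I_im,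
        Complex.ofReal_re]
      ring
    simp only [hF, Complex.add_im, complexVelocity_im, Complex.im_ofReal_mul, hs]
  set U : Set ℂ := {z | (|z.re - x₀| < a ∧ y₀ < z.im) ∧ z.im < y₀ + b} with hUdef
  have hre : Continuous fun z : ℂ => |z.re - x₀| :=
    (Complex.continuous_re.sub continuous_const).abs
  have hUo : IsOpen U :=
    ((isOpen_lt hre continuous_const).inter
      (isOpen_lt continuous_const Complex.continuous_im)).inter
      (isOpen_lt Complex.continuous_im continuous_const)
  have hcl : closure U ⊆ {z | (|z.re - x₀| ≤ a ∧ y₀ ≤ z.im) ∧ z.im ≤ y₀ + b} :=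
    closure_minimal (fun z hz => ⟨⟨hz.1.1.le, hz.1.2.le⟩, le_of_lt hz.2⟩)
      (((isClosed_le hre continuous_const).inter
        (isClosed_le continuous_const Complex.continuous_im)).inter
        (isClosed_le Complex.continuous_im continuous_const))
  have hbdd : Bornology.IsBounded U :=
    isBounded_of_re_im_bounds (a := x₀ - a) (b := x₀ + a) (c := y₀) (d := y₀ + b) fun z hz => by
      have := abs_lt.1 hz.1.1
      exact ⟨⟨by linarith, by linarith⟩, hz.1.2.le, le_of_lt hz.2⟩
  have hFc : Continuous F := by
    have h1 : Continuous fun w : ℂ => u w.re w.im :=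
      hu.comp (Complex.continuous_re.prodMk Complex.continuous_im)
    have h2 : Continuous fun w : ℂ => v w.re w.im :=
      hv.comp (Complex.continuous_re.prodMk Complex.continuous_im)
    simp only [hF, complexVelocity]
    fun_prop
  have hFd : DiffContOnCl ℂ F U := by
    refine ⟨fun z hz => (DifferentiableAt.add (hf z hz.1.1 hz.1.2 hz.2) ?_).differentiableWithinAt,
      hFc.continuousOn⟩
    fun_prop
  have hfront : ∀ z ∈ frontier U, (F z).im ≤ 0 := by
    intro z hz
    rw [hUo.frontier_eq] at hz
    obtain ⟨⟨⟨h0, h1⟩, h2⟩, hnot⟩ := And.intro (hcl hz.1) hz.2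
    rw [hFim]
    rcases h1.eq_or_lt with h1 | h1
    · rw [← h1, hbed]; simp
    have hvpos := hpos z.re z.im h0 h1 h2
    rcases h0.eq_or_lt with h0 | h0
    · have : Real.cos (k * (z.re - x₀)) = 0 := by
        rw [← Real.cos_abs, abs_mul, h0, abs_of_pos hkpos, hka, Real.cos_pi_div_two]
      rw [this]; linarith
    rcases h2.eq_or_lt with h2 | h2
    · have hmz : m ≤ v z.re z.im := by
        have := abs_lt.1 h0
        rw [h2]
        exact hmin (show z.re ∈ Set.Icc (x₀ - a) (x₀ + a) from ⟨by linarith, by linarith⟩)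
      have : δ * Real.sinh (k * (z.im - y₀)) = m := by
        rw [h2, add_sub_cancel_left, hδ, div_mul_cancel₀ _ hsh.ne']
      nlinarith [Real.cos_le_one (k * (z.re - x₀))]
    · exact absurd ⟨⟨h0, h1⟩, h2⟩ hnot
  have hbar : ∀ y, y₀ < y → y < y₀ + b → δ * Real.sinh (k * (y - y₀)) ≤ v x₀ y := by
    intro y hy1 hy2
    have hmem : (⟨x₀, y⟩ : ℂ) ∈ U := ⟨⟨by simpa using ha, hy1⟩, hy2⟩
    have := im_le_of_forall_mem_frontier_im_le hbdd hFd hfront (subset_closure hmem)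
    rw [hFim] at this
    simp only [sub_self, mul_zero, Real.cos_zero, one_mul] at this
    linarith
  have hbar' : HasDerivAt (fun t => δ * Real.sinh (k * (t - y₀))) (δ * k) y₀ := by
    have h := ((((hasDerivAt_id y₀).sub_const y₀).const_mul k).sinh).const_mul δ
    simpa using h
  have hdiff := (hd.sub hbar').hasDerivWithinAt (s := Set.Ioi y₀)
  rw [hasDerivWithinAt_iff_tendsto_slope' (by simp)] at hdiff
  have hge : 0 ≤ v' - δ * k := by
    refine ge_of_tendsto hdiff ?_
    filter_upwards [Ioo_mem_nhdsGT (show y₀ < y₀ + b by linarith)] with y hy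
    have := hbar y hy.1 hy.2
    rw [slope_def_field]
    refine div_nonneg ?_ (by linarith [hy.1])
    simp [hbed]
    linarith
  nlinarith [mul_pos hδpos hkpos]

/-- The dynamic pressure is strictly decreasing along the bed away from the crest:
`p_x(x,-d) < 0` for every `x > 0`, hence `x ↦ p(x,-d)` is strictly decreasing on `[0,∞)`. -/
theorem dynamic_pressure_decreasing_along_bed
    (d g c P_atm : ℝ) (hd : 0 < d) (hg : 0 < g) (hc : Real.sqrt (g * d) < c)
    (η : ℝ → ℝ) (hη : ContDiff ℝ (⊤ : ℕ∞) η)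
    (hηd : ∀ x, -d < η x) (hηeven : ∀ x, η (-x) = η x)
    (hηdec : StrictAntiOn η (Set.Ioi 0))
    (hηlim : Filter.Tendsto η (Filter.cocompact ℝ) (nhds 0))
    (Ω : Set (ℝ × ℝ)) (hΩ : Ω = {q : ℝ × ℝ | -d < q.2 ∧ q.2 < η q.1})
    (u v : ℝ → ℝ → ℝ)
    (hu : ContDiff ℝ (⊤ : ℕ∞) (fun q : ℝ × ℝ => u q.1 q.2))
    (hv : ContDiff ℝ (⊤ : ℕ∞) (fun q : ℝ × ℝ => v q.1 q.2))
    (hinc : ∀ x y, (x, y) ∈ closure Ω → pdx u x y + pdy v x y = 0)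
    (hirr : ∀ x y, (x, y) ∈ closure Ω → pdy u x y - pdx v x y = 0)
    (hsurfv : ∀ x, v x (η x) = (u x (η x) - c) * deriv η x)
    (hbed : ∀ x, v x (-d) = 0)
    (hvsym : ∀ x y, v (-x) y = -v x y)
    (huc : ∀ x y, (x, y) ∈ closure Ω → u x y < c)
    (hvlim : ∀ ε > 0, ∃ R > 0, ∀ x y, (x, y) ∈ closure Ω → R < |x| → |v x y| < ε)
    (p : ℝ → ℝ → ℝ)
    (hp : ∀ x y, p x y = c ^ 2 / 2 - (1 / 2) * ((v x y) ^ 2 + (u x y - c) ^ 2)) :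
    (∀ x : ℝ, 0 < x → pdx p x (-d) < 0) ∧
    StrictAntiOn (fun x => p x (-d)) (Set.Ici 0) := by
  subst hΩ
  have hηc : Continuous η := hη.continuous
  have hdom : ∀ {x y : ℝ}, -d ≤ y → y ≤ η x →
      (x, y) ∈ closure {q : ℝ × ℝ | -d < q.2 ∧ q.2 < η q.1} := fun h1 h2 =>
    mem_closure_fluid hηd h1 h2
  have hdiff : ∀ z ∈ rightHalf d η, DifferentiableAt ℂ (complexVelocity u v) z := fun z hz =>
    differentiableAt_complexVelocity hu hv (hinc _ _ (hdom hz.2.1.le hz.2.2.le))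
      (hirr _ _ (hdom hz.2.1.le hz.2.2.le))
  have hf : DifferentiableOn ℂ (complexVelocity u v) (rightHalf d η) := fun z hz =>
    (hdiff z hz).differentiableWithinAt
  have hcrest : ∀ y, v 0 y = 0 := fun y => by
    have := hvsym 0 y
    rw [neg_zero] at this
    linarith
  have hη' : ∀ x, 0 < x → deriv η x ≤ 0 := fun x hx => by
    rw [← derivWithin_of_isOpen isOpen_Ioi (Set.mem_Ioi.2 hx)]
    exact hηdec.antitoneOn.derivWithin_nonpos
  have hbedlt : ∀ x, u x (-d) < c := fun x => huc _ _ (hdom le_rfl (hηd x).le)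
  have hsurflt : ∀ x, u x (η x) < c := fun x => huc _ _ (hdom (hηd x).le le_rfl)
  have hnonneg := nonneg_on_rightHalf hηc hv.continuous hu.continuous hf
    (fun x hx => by
      rw [hsurfv]
      exact mul_nonneg_of_nonpos_of_nonpos (by linarith [hsurflt x]) (hη' x hx))
    hbed hcrest
    (fun ε hε => by
      obtain ⟨R, hR, h⟩ := hvlim ε hε
      exact ⟨R, hR, fun x y h1 h2 => h x y (hdom h1 h2)⟩)
  obtain ⟨x₁, hx₁, hslope⟩ := exists_deriv_eq_slope η (show (1 : ℝ) < 2 by norm_num)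
    hηc.continuousOn (hη.differentiable (by simp)).differentiableOn
  have hx₁pos : 0 < x₁ := by linarith [hx₁.1]
  have hsurfpos : 0 < v x₁ (η x₁) := by
    have := hηdec (Set.mem_Ioi.2 one_pos) (Set.mem_Ioi.2 two_pos) one_lt_two
    rw [hsurfv, hslope]
    refine mul_pos_of_neg_of_neg (by linarith [hsurflt x₁]) ?_
    exact div_neg_of_neg_of_pos (by linarith) (by norm_num)
  have hpos := pos_on_rightHalf hηc hηd hv.continuous hf hnonneg hx₁pos hsurfpos
  have hvy : ∀ x, 0 < x → 0 < pdy v x (-d) := by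
    intro x hx
    obtain ⟨xm, hxm, hmin⟩ := (isCompact_Icc (a := x - x / 2) (b := x + x / 2)).exists_isMinOn
      (Set.nonempty_Icc.2 (by linarith)) hηc.continuousOn
    have hmem : ∀ x' y, |x' - x| ≤ x / 2 → -d < y → y ≤ -d + (η xm + d) / 2 →
        (⟨x', y⟩ : ℂ) ∈ rightHalf d η := fun x' y h1 h2 h3 => by
      have habs := abs_le.1 h1
      have hle : η xm ≤ η x' :=
        hmin (show x' ∈ Set.Icc (x - x / 2) (x + x / 2) from ⟨by linarith, by linarith⟩)
      refine ⟨?_, h2, ?_⟩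
      · change 0 < x'
        linarith
      · change y < η x'
        linarith [hηd xm]
    have hder := hasDerivAt_snd_slice hv x (-d)
    rw [pdy, hder.deriv]
    exact hopf_flat hv.continuous hu.continuous (half_pos hx) (b := (η xm + d) / 2)
      (by linarith [hηd xm])
      (fun z h1 h2 h3 => hdiff z (hmem z.re z.im h1.le h2 h3.le)) hbed
      (fun x' y h1 h2 h3 => hpos _ (hmem x' y h1 h2 h3)) hder
  have hpbed : (fun t => p t (-d)) = fun t => c ^ 2 / 2 - (1 / 2) * (u t (-d) - c) ^ 2 := by
    funext t
    rw [hp, hbed]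
    ring
  have hpd : ∀ x, HasDerivAt (fun t => p t (-d)) ((u x (-d) - c) * pdy v x (-d)) x := by
    intro x
    have hux := hasDerivAt_fst_slice hu x (-d)
    have hincx := hinc x (-d) (hdom le_rfl (hηd x).le)
    rw [pdx, hux.deriv] at hincx
    rw [hpbed]
    refine ((((hux.sub_const c).pow 2).const_mul (1 / 2)).const_sub (c ^ 2 / 2)).congr_deriv ?_
    rw [eq_neg_of_add_eq_zero_left hincx]
    ring
  have hneg : ∀ x, 0 < x → (u x (-d) - c) * pdy v x (-d) < 0 := fun x hx =>
    mul_neg_of_neg_of_pos (by linarith [hbedlt x]) (hvy x hx)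
  refine ⟨fun x hx => ?_, ?_⟩
  · rw [pdx, (hpd x).deriv]
    exact hneg x hx
  · refine strictAntiOn_of_deriv_neg (convex_Ici 0)
      (fun x _ => (hpd x).continuousAt.continuousWithinAt) fun x hx => ?_
    rw [interior_Ici] at hx
    rw [(hpd x).deriv]
    exact hneg x hx
end

section
/- For the solitary wave of greatest height the strict positivity of the dynamic pressure persists: p(x,y) > 0 for every (x,y) ∈ Ω, even though the free surface has a corner at the crest and the horizontal velocity attains the wave speed there. -/
open Real Filter Set

open Complex in
/-- A continuous function on an open set that is holomorphic off the real axis is holomorphic. -/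
theorem differentiableOn_of_continuousOn_of_im_ne_zero {U : Set ℂ} (hU : IsOpen U) {f : ℂ → ℂ}
    (hc : ContinuousOn f U) (hd : ∀ z ∈ U, z.im ≠ 0 → DifferentiableAt ℂ f z) :
    DifferentiableOn ℂ f U := by
  refine (isConservativeOn_and_continuousOn_iff_isDifferentiableOn hU).1 ⟨?_, hc⟩
  have key : ∀ z w : ℂ, Rectangle z w ⊆ U → (0 : ℝ) ∉ Ioo (min z.im w.im) (max z.im w.im) →
      wedgeIntegral z w f + wedgeIntegral w z f = 0 := by
    intro z w hzw h0
    rw [wedgeIntegral_add_wedgeIntegral_eq]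
    refine integral_boundary_rect_eq_zero_of_continuousOn_of_differentiableOn f z w
      (hc.mono hzw) fun q hq => (hd q (hzw ?_) ?_).differentiableWithinAt
    · exact ⟨Ioo_subset_Icc_self hq.1, Ioo_subset_Icc_self hq.2⟩
    · intro h
      exact h0 (h ▸ hq.2)
  intro z w hzw
  rw [← add_eq_zero_iff_eq_neg]
  by_cases h0 : (0 : ℝ) ∈ uIcc z.im w.im
  · have h1 := key z ⟨w.re, 0⟩ (fun q hq => hzw
      ⟨hq.1, uIcc_subset_uIcc left_mem_uIcc h0 hq.2⟩) (by
        rintro ⟨h, h'⟩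
        rcases le_total z.im 0 with hz | hz <;> simp [hz] at h h')
    have h2 := key ⟨z.re, 0⟩ w (fun q hq => hzw
      ⟨hq.1, uIcc_subset_uIcc h0 right_mem_uIcc hq.2⟩) (by
        rintro ⟨h, h'⟩
        rcases le_total w.im 0 with hz | hz <;> simp [hz] at h h')
    have hint : ∀ x ∈ uIcc z.re w.re, ∀ a ∈ uIcc z.im w.im, ∀ b ∈ uIcc z.im w.im,
        IntervalIntegrable (fun y : ℝ => f (x + y * I)) MeasureTheory.volume a b := by
      intro x hx a ha b hb
      refine ContinuousOn.intervalIntegrable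
        (hc.comp (Continuous.continuousOn (by fun_prop)) fun y hy => hzw ?_)
      exact ⟨by simpa using hx, by simpa using uIcc_subset_uIcc ha hb hy⟩
    rw [wedgeIntegral_add_wedgeIntegral_eq] at h1 h2 ⊢
    have e1 := intervalIntegral.integral_add_adjacent_intervals
      (hint w.re right_mem_uIcc z.im left_mem_uIcc 0 h0)
      (hint w.re right_mem_uIcc 0 h0 w.im right_mem_uIcc)
    have e2 := intervalIntegral.integral_add_adjacent_intervals
      (hint z.re left_mem_uIcc z.im left_mem_uIcc 0 h0)
      (hint z.re left_mem_uIcc 0 h0 w.im right_mem_uIcc)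
    rw [← e1, ← e2, smul_add, smul_add]
    simp only at h1 h2
    linear_combination h1 + h2
  · exact key z w hzw fun h => h0 (Ioo_subset_Icc_self h)

/-- The set of points lying strictly between a continuous curve in the upper half-plane and its
mirror image is connected. -/
theorem isPreconnected_abs_im_lt {h : ℝ → ℝ} (hc : Continuous h) (hpos : ∀ x, 0 < h x) :
    IsPreconnected {z : ℂ | |z.im| < h z.re} := by
  have := ((isPreconnected_univ (α := ℝ)).prod (isPreconnected_Ioo (a := (-1 : ℝ)) (b := 1))).image
    (fun q : ℝ × ℝ => (q.1 : ℂ) + (q.2 * h q.1 : ℝ) * Complex.I)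
    (Continuous.continuousOn (by fun_prop))
  convert this using 1
  ext z
  constructor
  · intro hz
    have hz' := abs_lt.1 (show |z.im| < h z.re from hz)
    refine ⟨(z.re, z.im / h z.re), ⟨mem_univ _, ?_, ?_⟩, ?_⟩
    · rw [lt_div_iff₀ (hpos _)]; linarith
    · rw [div_lt_iff₀ (hpos _)]; linarith
    · simp only [div_mul_cancel₀ _ (hpos z.re).ne']
      exact Complex.re_add_im z
  · rintro ⟨⟨x, t⟩, ⟨-, ht⟩, rfl⟩
    have := hpos x
    simp only [mem_ofPred_eq, Complex.add_im, Complex.ofReal_im, Complex.mul_im, Complex.ofReal_re,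
      Complex.I_im, Complex.I_re, Complex.add_re, Complex.mul_re]
    ring_nf
    rw [abs_mul, abs_of_pos this]
    nlinarith [abs_lt.2 ht]

/-- Maximum principle for a function holomorphic between two mirror-image curves, except possibly
on the axis, where it is only assumed to be continuous. -/
theorem norm_lt_of_abs_im_lt {h : ℝ → ℝ} (hc : Continuous h) (hpos : ∀ x, 0 < h x)
    {M : ℝ} (hM : ∀ x, h x ≤ M) {F : ℂ → ℂ} {C : ℝ}
    (hF : ContinuousOn F {z : ℂ | |z.im| ≤ h z.re})
    (hd : ∀ z : ℂ, |z.im| < h z.re → z.im ≠ 0 → DifferentiableAt ℂ F z)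
    (hbdry : ∀ z : ℂ, |z.im| = h z.re → ‖F z‖ < C)
    (hinf : ∀ ε > 0, ∃ R : ℝ, ∀ z : ℂ, |z.im| ≤ h z.re → R < |z.re| → ‖F z‖ ≤ C + ε)
    {z : ℂ} (hz : |z.im| < h z.re) : ‖F z‖ < C := by
  set D : Set ℂ := {z : ℂ | |z.im| < h z.re} with hD
  have hDo : IsOpen D := isOpen_lt (by fun_prop) (by fun_prop)
  have hKc : IsClosed {z : ℂ | |z.im| ≤ h z.re} := isClosed_le (by fun_prop) (by fun_prop)
  have hDK : D ⊆ {z : ℂ | |z.im| ≤ h z.re} := fun w hw =>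
    show |w.im| ≤ h w.re from le_of_lt hw
  have hdiff : DifferentiableOn ℂ F D :=
    differentiableOn_of_continuousOn_of_im_ne_zero hDo (hF.mono hDK) hd
  have hle : ∀ w ∈ D, ‖F w‖ ≤ C := by
    intro w hw
    refine le_of_forall_pos_le_add fun ε hε => ?_
    obtain ⟨R, hR⟩ := hinf ε hε
    set L := max R |w.re| + 1 with hL
    have hLR : R < L := by have := le_max_left R |w.re|; linarith
    have hLw : |w.re| < L := by have := le_max_right R |w.re|; linarith
    set U : Set ℂ := D ∩ {q : ℂ | |q.re| < L} with hU
    have hUo : IsOpen U := hDo.inter (isOpen_lt (by fun_prop) (by fun_prop))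
    have hUcl : closure U ⊆ {q : ℂ | |q.im| ≤ h q.re} ∩ {q : ℂ | |q.re| ≤ L} :=
      closure_minimal (fun q hq => ⟨hDK hq.1, show |q.re| ≤ L from le_of_lt hq.2⟩)
        (hKc.inter (isClosed_le (by fun_prop) (by fun_prop)))
    have hUb : Bornology.IsBounded U := by
      refine isBounded_iff_forall_norm_le.2 ⟨L + M, fun q hq => ?_⟩
      have h1 : |q.im| < h q.re := hq.1
      have h2 : |q.re| < L := hq.2
      linarith [Complex.norm_le_abs_re_add_abs_im q, hM q.re]
    refine Complex.norm_le_of_forall_mem_frontier_norm_le hUb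
      ⟨hdiff.mono inter_subset_left, hF.mono (hUcl.trans inter_subset_left)⟩ (fun q hq => ?_)
      (subset_closure (⟨hw, hLw⟩ : w ∈ U))
    obtain ⟨h1, h2⟩ := hUcl hq.1
    have hq2 : q ∉ U := by rw [← hUo.interior_eq]; exact hq.2
    replace h1 : |q.im| ≤ h q.re := h1
    replace h2 : |q.re| ≤ L := h2
    rcases h1.lt_or_eq with h3 | h3
    · rcases h2.lt_or_eq with h4 | h4
      · exact absurd ⟨h3, h4⟩ hq2
      · exact hR q h1 (h4 ▸ hLR)
    · linarith [hbdry q h3]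
  refine lt_of_le_of_ne (hle z hz) fun heq => ?_
  have hmax : IsMaxOn (norm ∘ F) D z := fun w hw => by
    simpa [heq] using hle w hw
  have hconst := Complex.norm_eqOn_of_isPreconnected_of_isMaxOn
    (isPreconnected_abs_im_lt hc hpos) hDo hdiff hz hmax
  have hcurve : ∀ t ∈ Icc (0 : ℝ) (h 0), ‖F (t * Complex.I)‖ = C := by
    have hcl : Icc (0 : ℝ) (h 0) = closure (Ioo 0 (h 0)) := (closure_Ioo (hpos 0).ne).symm
    refine EqOn.of_subset_closure (s := Ioo 0 (h 0)) (fun t ht => ?_) ?_ continuousOn_const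
      Ioo_subset_Icc_self hcl.subset
    · refine (hconst ?_).trans heq
      simpa [hD, abs_of_pos ht.1] using ht.2
    · refine (hF.comp (Continuous.continuousOn (by fun_prop)) fun t ht => ?_).norm
      simpa [abs_of_nonneg ht.1] using ht.2
  have h1 := hcurve (h 0) ⟨(hpos 0).le, le_rfl⟩
  have h2 := hbdry (h 0 * Complex.I) (by simp [abs_of_pos (hpos 0)])
  linarith

open ComplexConjugate in
/-- Maximum principle above a straight bed on which the function is real: no condition on the
modulus is needed on the bed. -/
theorem norm_lt_of_im_eq_zero_on_bed {h : ℝ → ℝ} (hc : Continuous h) (hpos : ∀ x, 0 < h x)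
    {M : ℝ} (hM : ∀ x, h x ≤ M) {f : ℂ → ℂ} {C : ℝ}
    (hf : ContinuousOn f {z : ℂ | 0 ≤ z.im ∧ z.im ≤ h z.re})
    (hd : ∀ z : ℂ, 0 < z.im → z.im < h z.re → DifferentiableAt ℂ f z)
    (hreal : ∀ z : ℂ, z.im = 0 → (f z).im = 0)
    (hbdry : ∀ z : ℂ, z.im = h z.re → ‖f z‖ < C)
    (hinf : ∀ ε > 0, ∃ R : ℝ, ∀ z : ℂ, 0 ≤ z.im → z.im ≤ h z.re → R < |z.re| → ‖f z‖ ≤ C + ε)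
    {z : ℂ} (hz0 : 0 ≤ z.im) (hz : z.im < h z.re) : ‖f z‖ < C := by
  set F : ℂ → ℂ := fun z => if 0 ≤ z.im then f z else conj (f (conj z)) with hFdef
  have hup : ∀ z : ℂ, 0 ≤ z.im → F z = f z := fun z hz => if_pos hz
  have hdown : ∀ z : ℂ, z.im ≤ 0 → F z = conj (f (conj z)) := by
    intro z hz
    rcases hz.lt_or_eq with h | h
    · exact if_neg (not_le.2 h)
    · rw [hup z h.ge, Complex.conj_eq_iff_im.2 h, Complex.conj_eq_iff_im.2 (hreal z h)]
  have hnorm : ∀ z : ℂ, z.im ≤ 0 → ‖F z‖ = ‖f (conj z)‖ := fun z hz => by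
    rw [hdown z hz, Complex.norm_conj]
  rw [← hup z hz0]
  refine norm_lt_of_abs_im_lt hc hpos hM (F := F) ?_ ?_ ?_ ?_ (by rwa [abs_of_nonneg hz0])
  · have hK : {z : ℂ | |z.im| ≤ h z.re} =
        {z : ℂ | 0 ≤ z.im ∧ z.im ≤ h z.re} ∪ {z : ℂ | z.im ≤ 0 ∧ -z.im ≤ h z.re} := by
      ext z
      simp only [mem_ofPred_eq, mem_union, abs_le]
      have := hpos z.re
      constructor
      · rintro ⟨h1, h2⟩
        rcases le_total 0 z.im with h | h
        · exact Or.inl ⟨h, h2⟩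
        · exact Or.inr ⟨h, by linarith⟩
      · rintro (⟨h1, h2⟩ | ⟨h1, h2⟩) <;> constructor <;> linarith
    rw [hK]
    refine ContinuousOn.union_of_isClosed (hf.congr fun z hz => hup z hz.1)
      (ContinuousOn.congr (f := fun z => conj (f (conj z))) ?_ fun z hz => hdown z hz.1) ?_ ?_
    · refine Complex.continuous_conj.comp_continuousOn
        (hf.comp Complex.continuous_conj.continuousOn fun z hz => ?_)
      simpa using hz
    · exact (isClosed_le continuous_const Complex.continuous_im).inter
        (isClosed_le Complex.continuous_im (hc.comp Complex.continuous_re))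
    · exact (isClosed_le Complex.continuous_im continuous_const).inter
        (isClosed_le Complex.continuous_im.neg (hc.comp Complex.continuous_re))
  · intro z hz hz1
    rcases lt_or_gt_of_ne hz1 with h | h
    · have h1 : DifferentiableAt ℂ f (conj z) :=
        hd _ (by simpa using h) (by simpa [abs_of_neg h] using hz)
      have h2 := h1.conj_conj
      rw [Complex.conj_conj] at h2
      refine h2.congr_of_eventuallyEq ?_
      filter_upwards [(isOpen_lt Complex.continuous_im continuous_const).mem_nhds h] with w hw
      exact hdown w (le_of_lt hw)
    · refine (hd z h (by rwa [abs_of_pos h] at hz)).congr_of_eventuallyEq ?_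
      filter_upwards [(isOpen_lt continuous_const Complex.continuous_im).mem_nhds h] with w hw
      exact hup w (le_of_lt hw)
  · intro z hz
    rcases le_total 0 z.im with h | h
    · rw [hup z h]
      exact hbdry z (by rwa [abs_of_nonneg h] at hz)
    · rw [hnorm z h]
      exact hbdry _ (by simpa [abs_of_nonpos h] using hz)
  · intro ε hε
    obtain ⟨R, hR⟩ := hinf ε hε
    refine ⟨R, fun z hz hzR => ?_⟩
    rcases le_total 0 z.im with h | h
    · rw [hup z h]
      exact hR z h (by rwa [abs_of_nonneg h] at hz) hzR
    · rw [hnorm z h]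
      exact hR _ (by simpa using h) (by simpa [abs_of_nonpos h] using hz) (by simpa using hzR)

/-- The derivative of a function of two variables in terms of its partial derivatives. -/
theorem hasFDerivAt_pdx_pdy {f : ℝ → ℝ → ℝ} {x y : ℝ}
    (hf : DifferentiableAt ℝ (fun q : ℝ × ℝ => f q.1 q.2) (x, y)) :
    HasFDerivAt (fun q : ℝ × ℝ => f q.1 q.2)
      (pdx f x y • ContinuousLinearMap.fst ℝ ℝ ℝ + pdy f x y • ContinuousLinearMap.snd ℝ ℝ ℝ)
      (x, y) := by
  have h := hf.hasFDerivAt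
  have hx : HasDerivAt (fun t => f t y) _ x :=
    HasFDerivAt.comp_hasDerivAt (f := fun t : ℝ => (t, y)) x h
      ((hasDerivAt_id x).prodMk (hasDerivAt_const x y))
  have hy : HasDerivAt (fun t => f x t) _ y :=
    HasFDerivAt.comp_hasDerivAt (f := fun t : ℝ => (x, t)) y h
      ((hasDerivAt_const y x).prodMk (hasDerivAt_id y))
  convert h using 1
  ext
  · simpa [pdx] using hx.deriv
  · simpa [pdy] using hy.deriv

/-- An even function, strictly decreasing on the positive axis and vanishing at infinity, is
positive. -/
theorem pos_of_even_of_strictAntiOn {η : ℝ → ℝ} (hcont : Continuous η)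
    (heven : ∀ x, η (-x) = η x) (hdec : StrictAntiOn η (Ioi 0))
    (hlim : Tendsto η (cocompact ℝ) (nhds 0)) (x : ℝ) : 0 < η x ∧ η x ≤ η 0 := by
  have hlim' : Tendsto η atTop (nhds 0) := hlim.mono_left atTop_le_cocompact
  have hpos : ∀ x > 0, 0 < η x := by
    intro x hx
    have h1 : η (x + 1) < η x := hdec hx (show 0 < x + 1 by linarith) (by linarith)
    refine lt_of_le_of_lt (le_of_tendsto hlim' ?_) h1
    filter_upwards [eventually_ge_atTop (x + 1)] with t ht
    exact hdec.antitoneOn (show 0 < x + 1 by linarith) (show 0 < t by linarith) ht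
  have hle : ∀ x > 0, η x ≤ η 0 := by
    intro x hx
    have h1 : Tendsto η (nhdsWithin 0 (Ioi 0)) (nhds (η 0)) :=
      hcont.continuousAt.mono_left inf_le_left
    refine ge_of_tendsto h1 ?_
    filter_upwards [Ioo_mem_nhdsGT hx] with t ht
    exact hdec.antitoneOn ht.1 hx ht.2.le
  rcases lt_trichotomy x 0 with h | h | h
  · rw [← heven]
    exact ⟨hpos _ (by linarith), hle _ (by linarith)⟩
  · subst h
    exact ⟨(hpos 1 one_pos).trans_le (hle 1 one_pos), le_rfl⟩
  · exact ⟨hpos x h, hle x h⟩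

/-- The region between a bed and a continuous surface is connected. -/
theorem isPreconnected_between {d : ℝ} {η : ℝ → ℝ} (hη : Continuous η) (hd : ∀ x, -d < η x) :
    IsPreconnected {q : ℝ × ℝ | -d < q.2 ∧ q.2 < η q.1} := by
  have := ((isPreconnected_univ (α := ℝ)).prod (isPreconnected_Ioo (a := (0 : ℝ)) (b := 1))).image
    (fun q : ℝ × ℝ => (q.1, -d + q.2 * (η q.1 + d))) (Continuous.continuousOn (by fun_prop))
  convert this using 1
  ext ⟨x, y⟩
  have hx : 0 < η x + d := by linarith [hd x]
  constructor
  · rintro ⟨h1, h2⟩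
    simp only at h1 h2
    refine ⟨(x, (y + d) / (η x + d)), ⟨mem_univ _, div_pos (by linarith) hx, ?_⟩, ?_⟩
    · rw [div_lt_one hx]; linarith
    · simp [div_mul_cancel₀ _ hx.ne']
  · rintro ⟨⟨x', t⟩, ⟨-, h1, h2⟩, h⟩
    simp only [Prod.mk.injEq] at h h1 h2
    obtain ⟨rfl, rfl⟩ := h
    constructor <;> simp only <;> nlinarith

theorem mem_closure_between {d : ℝ} {η : ℝ → ℝ} (hd : ∀ x, -d < η x) {x y : ℝ}
    (h1 : -d ≤ y) (h2 : y ≤ η x) :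
    (x, y) ∈ closure {q : ℝ × ℝ | -d < q.2 ∧ q.2 < η q.1} := by
  have hy : y ∈ closure (Ioo (-d) (η x)) := by
    rw [closure_Ioo (hd x).ne]
    exact ⟨h1, h2⟩
  exact map_mem_closure (f := fun t : ℝ => (x, t)) (by fun_prop) hy fun t ht => ht

/-- For the solitary wave of greatest height the strict positivity of the dynamic
pressure persists: `p > 0` throughout `Ω`, even though the free surface has a corner
(of angle `2π/3`) at the crest and the horizontal velocity attains the wave speed
there. -/
theorem dynamic_pressure_positive_greatest_height
    (d g c P_atm : ℝ) (hd : 0 < d) (hg : 0 < g) (hc : Real.sqrt (g * d) < c)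
    (η : ℝ → ℝ) (hηcont : Continuous η)
    (hηeven : ∀ x, η (-x) = η x)
    (hηdec : StrictAntiOn η (Set.Ioi 0))
    (hηd : ∀ x, -d < η x)
    (hηlim : Filter.Tendsto η (Filter.cocompact ℝ) (nhds 0))
    (hηsmooth : ContDiffOn ℝ (⊤ : ℕ∞) η {0}ᶜ)
    (hcorner_right : HasDerivWithinAt η (-Real.tan (Real.pi / 6)) (Set.Ioi 0) 0)
    (hcorner_left : HasDerivWithinAt η (Real.tan (Real.pi / 6)) (Set.Iio 0) 0)
    (Ω : Set (ℝ × ℝ)) (hΩ : Ω = {q : ℝ × ℝ | -d < q.2 ∧ q.2 < η q.1})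
    (u v P : ℝ → ℝ → ℝ)
    (hu : ContDiffOn ℝ (⊤ : ℕ∞) (fun q : ℝ × ℝ => u q.1 q.2) Ω)
    (hv : ContDiffOn ℝ (⊤ : ℕ∞) (fun q : ℝ × ℝ => v q.1 q.2) Ω)
    (hP : ContDiffOn ℝ (⊤ : ℕ∞) (fun q : ℝ × ℝ => P q.1 q.2) Ω)
    (hucont : ContinuousOn (fun q : ℝ × ℝ => u q.1 q.2) (closure Ω))
    (hvcont : ContinuousOn (fun q : ℝ × ℝ => v q.1 q.2) (closure Ω))
    (hPcont : ContinuousOn (fun q : ℝ × ℝ => P q.1 q.2) (closure Ω))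
    (hinc : ∀ x y, (x, y) ∈ Ω → pdx u x y + pdy v x y = 0)
    (hirr : ∀ x y, (x, y) ∈ Ω → pdy u x y - pdx v x y = 0)
    (heuler1 : ∀ x y, (x, y) ∈ Ω →
      (u x y - c) * pdx u x y + v x y * pdy u x y = -pdx P x y)
    (heuler2 : ∀ x y, (x, y) ∈ Ω →
      (u x y - c) * pdx v x y + v x y * pdy v x y = -pdy P x y - g)
    (hsurfP : ∀ x, x ≠ 0 → P x (η x) = P_atm)
    (hsurfv : ∀ x, x ≠ 0 → v x (η x) = (u x (η x) - c) * deriv η x)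
    (hbed : ∀ x, v x (-d) = 0)
    (husym : ∀ x y, u (-x) y = u x y)
    (hvsym : ∀ x y, v (-x) y = -v x y)
    (huc : ∀ x y, (x, y) ∈ closure Ω → u x y ≤ c)
    (hcrest : ∀ x y, (x, y) ∈ closure Ω → u x y = c → (x, y) = (0, η 0))
    (hulim : ∀ ε > 0, ∃ R > 0, ∀ x y, (x, y) ∈ closure Ω → R < |x| → |u x y| < ε)
    (hvlim : ∀ ε > 0, ∃ R > 0, ∀ x y, (x, y) ∈ closure Ω → R < |x| → |v x y| < ε)
    (p : ℝ → ℝ → ℝ) (hp : ∀ x y, p x y = P x y - (P_atm - g * y)) :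
    ∀ x y, (x, y) ∈ Ω → 0 < p x y := by
  have hΩo : IsOpen Ω := by
    rw [hΩ]
    exact (isOpen_lt continuous_const continuous_snd).inter
      (isOpen_lt continuous_snd (hηcont.comp continuous_fst))
  have hΩc : IsPreconnected Ω := hΩ ▸ isPreconnected_between hηcont hηd
  have hcl : ∀ x y, -d ≤ y → y ≤ η x → (x, y) ∈ closure Ω := fun x y h1 h2 =>
    hΩ ▸ mem_closure_between hηd h1 h2
  have hηpos := pos_of_even_of_strictAntiOn hηcont hηeven hηdec hηlim
  have hc0 : 0 < c := (Real.sqrt_nonneg _).trans_lt hc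
  have hderiv : ∀ f : ℝ → ℝ → ℝ, ContDiffOn ℝ (⊤ : ℕ∞) (fun q : ℝ × ℝ => f q.1 q.2) Ω →
      ∀ x y, (x, y) ∈ Ω → HasFDerivAt (fun q : ℝ × ℝ => f q.1 q.2)
        (pdx f x y • ContinuousLinearMap.fst ℝ ℝ ℝ + pdy f x y • ContinuousLinearMap.snd ℝ ℝ ℝ)
        (x, y) := fun f hf x y hxy =>
    hasFDerivAt_pdx_pdy ((hf.contDiffAt (hΩo.mem_nhds hxy)).differentiableAt (by simp))
  -- The Bernoulli law
  obtain ⟨E, hE⟩ : ∃ E, ∀ q ∈ Ω,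
      P q.1 q.2 + ((u q.1 q.2 - c) ^ 2 + v q.1 q.2 ^ 2) / 2 + g * q.2 = E := by
    have hB : ∀ q ∈ Ω, HasFDerivAt (fun q : ℝ × ℝ =>
        P q.1 q.2 + ((u q.1 q.2 - c) ^ 2 + v q.1 q.2 ^ 2) / 2 + g * q.2)
        (0 : ℝ × ℝ →L[ℝ] ℝ) q := by
      rintro ⟨x, y⟩ hq
      have h := ((hderiv P hP x y hq).add
        (((((hderiv u hu x y hq).sub_const c).pow 2).add ((hderiv v hv x y hq).pow 2)).mul_const
          (1 / 2))).add ((hasFDerivAt_snd (𝕜 := ℝ) (p := (x, y))).const_mul g)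
      have e1 := heuler1 x y hq
      have e2 := heuler2 x y hq
      have e3 := hirr x y hq
      refine (h.congr_of_eventuallyEq (Eventually.of_forall fun q => ?_)).congr_fderiv ?_
      · simp
        ring
      · ext
        · simp
          linear_combination e1 - v x y * e3
        · simp
          linear_combination e2 + (u x y - c) * e3
    exact hΩo.exists_is_const_of_fderiv_eq_zero hΩc
      (fun q hq => (hB q hq).differentiableAt.differentiableWithinAt) fun q hq => (hB q hq).fderiv
  have hEcl : ∀ x y, (x, y) ∈ closure Ω →
      P x y + ((u x y - c) ^ 2 + v x y ^ 2) / 2 + g * y = E := by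
    have : EqOn (fun q : ℝ × ℝ => P q.1 q.2 + ((u q.1 q.2 - c) ^ 2 + v q.1 q.2 ^ 2) / 2 + g * q.2)
        (fun _ => E) (closure Ω) :=
      EqOn.of_subset_closure hE (by fun_prop) continuousOn_const subset_closure Subset.rfl
    exact fun x y h => this h
  have hsurf_mem : ∀ x, (x, η x) ∈ closure Ω := fun x => hcl x _ (hηd x).le le_rfl
  have hPsurf : ∀ x, P x (η x) = P_atm := by
    have h1 : Continuous fun x => P x (η x) :=
      hPcont.comp_continuous (f := fun x => (x, η x)) (by fun_prop) hsurf_mem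
    have h2 : Dense ({0}ᶜ : Set ℝ) := dense_compl_singleton 0
    exact fun x => congrFun (h1.ext_on h2 continuous_const fun x hx => hsurfP x hx) x
  have hEval : E = P_atm + c ^ 2 / 2 := by
    have hlim0 : ∀ f : ℝ → ℝ → ℝ,
        (∀ ε > 0, ∃ R > 0, ∀ x y, (x, y) ∈ closure Ω → R < |x| → |f x y| < ε) →
        Tendsto (fun x => f x (η x)) atTop (nhds 0) := by
      intro f hf
      rw [Metric.tendsto_nhds]
      intro ε hε
      obtain ⟨R, hR0, hR⟩ := hf ε hε
      filter_upwards [eventually_gt_atTop R] with x hx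
      simpa [Real.dist_eq] using hR x (η x) (hsurf_mem x) (hx.trans_le (le_abs_self x))
    have h1 := hlim0 u hulim
    have h2 := hlim0 v hvlim
    have h3 : Tendsto η atTop (nhds 0) := hηlim.mono_left atTop_le_cocompact
    have h4 := ((((h1.sub_const c).pow 2).add (h2.pow 2)).div_const 2).const_add P_atm |>.add
      (h3.const_mul g)
    have h5 : ∀ x, P_atm + ((u x (η x) - c) ^ 2 + v x (η x) ^ 2) / 2 + g * η x = E := fun x => by
      rw [← hPsurf x]
      exact hEcl x (η x) (hsurf_mem x)
    have := tendsto_nhds_unique (tendsto_const_nhds (x := E)) (h4.congr h5)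
    rw [this]
    ring
  set f : ℂ → ℂ := fun z => ⟨u z.re (z.im - d) - c, -v z.re (z.im - d)⟩ with hf
  have hnorm : ∀ z, ‖f z‖ ^ 2 = (u z.re (z.im - d) - c) ^ 2 + v z.re (z.im - d) ^ 2 := by
    intro z
    rw [Complex.sq_norm, Complex.normSq_apply]
    simp only [hf]
    ring
  have hshift : Continuous fun z : ℂ => (z.re, z.im - d) := by fun_prop
  intro x y hxy
  have hxy' : -d < y ∧ y < η x := by simpa [hΩ] using hxy
  have hlt : ‖f ⟨x, y + d⟩‖ < c := by
    refine norm_lt_of_im_eq_zero_on_bed (h := fun x => η x + d) (M := η 0 + d) (by fun_prop)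
      (fun x => by linarith [hηd x]) (fun x => by linarith [(hηpos x).2]) ?_ ?_ ?_ ?_ ?_
      (by simpa using (by linarith [hxy'.1] : 0 ≤ y + d)) (by simpa using hxy'.2)
    · have hmaps : MapsTo (fun z : ℂ => (z.re, z.im - d))
          {z : ℂ | 0 ≤ z.im ∧ z.im ≤ η z.re + d} (closure Ω) := fun z hz =>
        hcl _ _ (by linarith [hz.1]) (by linarith [hz.2])
      have h1 := hucont.comp hshift.continuousOn hmaps
      have h2 := hvcont.comp hshift.continuousOn hmaps
      have h3 := Complex.equivRealProdCLM.symm.continuous.comp_continuousOn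
        ((h1.sub (continuousOn_const (c := c))).prodMk h2.neg)
      refine h3.congr fun z hz => ?_
      simp [hf, Complex.equivRealProdCLM_symm_apply, Complex.ext_iff]
    · intro z hz1 hz2
      have hmem : (z.re, z.im - d) ∈ Ω := by
        rw [hΩ]
        exact ⟨by simp only; linarith, by simp only; linarith⟩
      have hs : HasFDerivAt (fun z : ℂ => (z.re, z.im - d)) (Complex.reCLM.prod Complex.imCLM) z :=
        Complex.reCLM.hasFDerivAt.prodMk (Complex.imCLM.hasFDerivAt.sub_const d)
      have h1 := ((hderiv u hu _ _ hmem).comp z hs).sub_const c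
      have h2 := ((hderiv v hv _ _ hmem).comp z hs).neg
      have h3 := Complex.equivRealProdCLM.symm.toContinuousLinearMap.hasFDerivAt.comp z
        (h1.prodMk h2)
      have h4 : HasFDerivAt f _ z := h3.congr_of_eventuallyEq (Eventually.of_forall fun w => by
        simp [hf, Complex.equivRealProdCLM_symm_apply, Complex.ext_iff])
      refine differentiableAt_complex_iff_differentiableAt_real.2 ⟨h4.differentiableAt, ?_⟩
      have e1 := hinc _ _ hmem
      have e2 := hirr _ _ hmem
      rw [h4.fderiv]
      simp [Complex.ext_iff, Complex.equivRealProdCLM_symm_apply]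
      constructor <;> linarith
    · intro z hz
      simp [hf, hz, hbed]
    · intro z hz
      have h1 := hEcl _ _ (hsurf_mem z.re)
      rw [hPsurf, hEval] at h1
      have h2 := hnorm z
      have h3 : z.im - d = η z.re := by linarith
      rw [h3] at h2
      have h4 := mul_pos hg (hηpos z.re).1
      exact lt_of_pow_lt_pow_left₀ 2 hc0.le (by linarith)
    · intro ε hε
      obtain ⟨R₁, -, h1⟩ := hulim (ε / 2) (by linarith)
      obtain ⟨R₂, -, h2⟩ := hvlim (ε / 2) (by linarith)
      refine ⟨max R₁ R₂, fun z hz1 hz2 hz3 => ?_⟩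
      have hmem := hcl z.re (z.im - d) (by linarith) (by linarith)
      have h3 := h1 _ _ hmem ((le_max_left _ _).trans_lt hz3)
      have h4 := h2 _ _ hmem ((le_max_right _ _).trans_lt hz3)
      have h5 := Complex.norm_le_abs_re_add_abs_im (f z)
      simp only [hf, abs_neg] at h5
      have h6 := abs_sub (u z.re (z.im - d)) c
      rw [abs_of_pos hc0] at h6
      linarith
  have h1 := hE _ hxy
  have h2 := hnorm ⟨x, y + d⟩
  have h3 : ‖f ⟨x, y + d⟩‖ ^ 2 < c ^ 2 := pow_lt_pow_left₀ hlt (norm_nonneg _) two_ne_zero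
  simp only [add_sub_cancel_right] at h1 h2
  rw [hp]
  linarith
end
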